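/- arXiv:2406.01479 — 4 statements merged into one kernel-verified Lean document; each statement's English description precedes it below -/
import Mathlib

section
/- Let γ₀, γ₁, …, γ₈ be positive reals with γ₀ + γ₁ + ⋯ + γ₈ = 1, and let ω₀, ω₁, …, ω₈ be reals with ω₀ + ω₁ + ⋯ + ω₈ = 1. Let h > 0 and C₁, C₂, C₃ ≥ 0 be constants such that |ω_k − γ_k| ≤ C₁·h for every k = 0, …, 8. Let u, q₀, q₁, …, q₈ : ℝ² → ℝ and let z ∈ ℝ² satisfy |q₀(z) − u(z)| ≤ C₂·h³ and |q_k(z) − u(z)| ≤ C₃·h² for k = 1, …, 8. Then the WENO combination u^WENO(z) := ω₀·( (1/γ₀)·q₀(z) − Σ_{k=1}^{8} (γ_k/γ₀)·q_k(z) ) + Σ_{k=1}^{8} ω_k·q_k(z) satisfies |u^WENO(z) − u(z)| ≤ C₂·h³ + (C₁/γ₀)·(C₂·h⁴ + C₃·h³) + 8·C₁·C₃·h³. -/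
open Finset

/-- A weighted sum of uniformly bounded errors is bounded by the total absolute weight times the
error bound. -/
theorem abs_sum_mul_le_of_abs_le {ι : Type*} (s : Finset ι) (a e : ι → ℝ) {B : ℝ}
    (he : ∀ k ∈ s, |e k| ≤ B) : |∑ k ∈ s, a k * e k| ≤ (∑ k ∈ s, |a k|) * B := by
  rw [Finset.sum_mul]
  refine (Finset.abs_sum_le_sum_abs _ _).trans (Finset.sum_le_sum fun k hk => ?_)
  rw [abs_mul]
  exact mul_le_mul_of_nonneg_left (he k hk) (abs_nonneg _)

/-- The error of the WENO combination, split into the error of the linear reconstruction and the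
contributions of the deviations `ω k - γ k`. -/
theorem weno_error_eq {ι : Type*} (s : Finset ι) (γ ω q : ι → ℝ) (γ₀ ω₀ q₀ u : ℝ) (hγ₀ : γ₀ ≠ 0)
    (hγ : γ₀ + ∑ k ∈ s, γ k = 1) (hω : ω₀ + ∑ k ∈ s, ω k = 1) :
    ω₀ * ((1 / γ₀) * q₀ - ∑ k ∈ s, (γ k / γ₀) * q k) + (∑ k ∈ s, ω k * q k) - u
      = (q₀ - u) + (ω₀ - γ₀) / γ₀ * ((q₀ - u) - ∑ k ∈ s, γ k * (q k - u))
        + ∑ k ∈ s, (ω k - γ k) * (q k - u) := by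
  have hdiv : ∑ k ∈ s, (γ k / γ₀) * q k = (∑ k ∈ s, γ k * q k) / γ₀ := by
    rw [Finset.sum_div]
    exact Finset.sum_congr rfl fun k _ => by ring
  simp only [hdiv, mul_sub, sub_mul, Finset.sum_sub_distrib, ← Finset.sum_mul]
  rw [eq_sub_of_add_eq' hγ, eq_sub_of_add_eq' hω]
  field_simp
  ring

/-- Accuracy of the third-order WENO-ZQ reconstruction: the nonlinearly weighted
combination of one third-order accurate polynomial `q 0` and eight second-order
accurate polynomials `q 1, …, q 8` is third-order accurate, given that the nonlinear
weights `ω` deviate from the positive linear weights `γ` (summing to one) by `O(h)`. -/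
theorem weno_zq_accuracy
    (γ ω : Fin 9 → ℝ)
    (hγpos : ∀ k, 0 < γ k) (hγsum : ∑ k, γ k = 1) (hωsum : ∑ k, ω k = 1)
    (h : ℝ) (hh : 0 < h)
    (C₁ C₂ C₃ : ℝ) (hC₁ : 0 ≤ C₁) (hC₂ : 0 ≤ C₂) (hC₃ : 0 ≤ C₃)
    (hclose : ∀ k, |ω k - γ k| ≤ C₁ * h)
    (u : ℝ × ℝ → ℝ) (q : Fin 9 → ℝ × ℝ → ℝ) (z : ℝ × ℝ)
    (hq0 : |q 0 z - u z| ≤ C₂ * h ^ 3)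
    (hqk : ∀ k, k ≠ 0 → |q k z - u z| ≤ C₃ * h ^ 2) :
    |ω 0 * ((1 / γ 0) * q 0 z - ∑ k ∈ Finset.univ.erase 0, (γ k / γ 0) * q k z)
        + (∑ k ∈ Finset.univ.erase 0, ω k * q k z) - u z|
      ≤ C₂ * h ^ 3 + (C₁ / γ 0) * (C₂ * h ^ 4 + C₃ * h ^ 3) + 8 * C₁ * C₃ * h ^ 3 := by
  have hγ : γ 0 + ∑ k ∈ Finset.univ.erase 0, γ k = 1 := by
    rw [Finset.add_sum_erase _ _ (Finset.mem_univ _), hγsum]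
  have hω : ω 0 + ∑ k ∈ Finset.univ.erase 0, ω k = 1 := by
    rw [Finset.add_sum_erase _ _ (Finset.mem_univ _), hωsum]
  have hγ0 := hγpos 0
  have he : ∀ k ∈ Finset.univ.erase (0 : Fin 9), |q k z - u z| ≤ C₃ * h ^ 2 :=
    fun k hk => hqk k (Finset.ne_of_mem_erase hk)
  have hB : 0 ≤ C₃ * h ^ 2 := by positivity
  have hlin : |∑ k ∈ Finset.univ.erase 0, γ k * (q k z - u z)| ≤ C₃ * h ^ 2 := by
    refine (abs_sum_mul_le_of_abs_le _ γ _ he).trans (mul_le_of_le_one_left hB ?_)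
    simp only [abs_of_pos (hγpos _)]
    linarith
  have hdev : |∑ k ∈ Finset.univ.erase 0, (ω k - γ k) * (q k z - u z)|
      ≤ 8 * (C₁ * h) * (C₃ * h ^ 2) := by
    refine (abs_sum_mul_le_of_abs_le _ (fun k => ω k - γ k) _ he).trans
      (mul_le_mul_of_nonneg_right ?_ hB)
    refine (Finset.sum_le_card_nsmul _ _ (C₁ * h) fun k _ => hclose k).trans_eq ?_
    simp [Finset.card_erase_of_mem]
  have hratio : |(ω 0 - γ 0) / γ 0| ≤ C₁ * h / γ 0 := by
    rw [abs_div, abs_of_pos hγ0]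
    exact div_le_div_of_nonneg_right (hclose 0) hγ0.le
  rw [weno_error_eq _ γ ω (fun k => q k z) (γ 0) (ω 0) (q 0 z) (u z) hγ0.ne' hγ hω]
  calc _ ≤ C₂ * h ^ 3 + C₁ * h / γ 0 * (C₂ * h ^ 3 + C₃ * h ^ 2)
        + 8 * (C₁ * h) * (C₃ * h ^ 2) := by
        refine (abs_add_le _ _).trans (add_le_add ((abs_add_le _ _).trans
          (add_le_add hq0 ?_)) hdev)
        rw [abs_mul]
        exact mul_le_mul hratio ((abs_sub _ _).trans (add_le_add hq0 hlin)) (abs_nonneg _)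
          (by positivity)
    _ = _ := by ring
end

section
/- Let Δx, Δy > 0, x_i, y_j ∈ ℝ, and set μ(x) = (x − x_i)/Δx, ν(y) = (y − y_j)/Δy, and let I = [x_i − Δx/2, x_i + Δx/2] × [y_j − Δy/2, y_j + Δy/2]. For real coefficients a₁, …, a₆ define the quadratic polynomial q(x,y) = a₁ + a₂·μ(x) + a₃·ν(y) + a₄·(μ(x)² − 1/12) + a₅·μ(x)·ν(y) + a₆·(ν(y)² − 1/12). Then (1/(Δx·Δy)) · Σ_{(l₁,l₂): 1 ≤ l₁+l₂ ≤ 2} ∫∫_I ( Δx^{l₁}·Δy^{l₂}·∂_x^{l₁}∂_y^{l₂} q(x,y) )² dx dy = a₂² + a₃² + (13/3)·a₄² + (7/6)·a₅² + (13/3)·a₆². -/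
open MeasureTheory

/-- The Eulerian cell `I = [xᵢ - Δx/2, xᵢ + Δx/2] × [yⱼ - Δy/2, yⱼ + Δy/2]`. -/
def eulerianCell (Δx Δy xi yj : ℝ) : Set (ℝ × ℝ) :=
  Set.Icc (xi - Δx / 2) (xi + Δx / 2) ×ˢ Set.Icc (yj - Δy / 2) (yj + Δy / 2)

/-- The integral over a centred interval of a squared affine function plus a constant. -/
lemma setIntegral_Icc_affine_sq_add {d : ℝ} (hd : 0 < d) (m c s k : ℝ) :
    ∫ t in Set.Icc (m - d / 2) (m + d / 2), ((c + s * ((t - m) / d)) ^ 2 + k)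
      = d * (c ^ 2 + s ^ 2 / 12 + k) := by
  rw [integral_Icc_eq_integral_Ioc, ← intervalIntegral.integral_of_le (by linarith)]
  have hderiv : ∀ t ∈ Set.uIcc (m - d / 2) (m + d / 2),
      HasDerivAt (fun t => c ^ 2 * (t - m) + c * s * (t - m) ^ 2 / d
        + s ^ 2 * (t - m) ^ 3 / (3 * d ^ 2) + k * (t - m))
        ((c + s * ((t - m) / d)) ^ 2 + k) t := by
    intro t _
    have h := (hasDerivAt_id' t).sub_const m
    refine HasDerivAt.congr_deriv ((((h.const_mul (c ^ 2)).add
      (((h.pow 2).const_mul (c * s)).div_const d)).add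
      (((h.pow 3).const_mul (s ^ 2)).div_const (3 * d ^ 2))).add (h.const_mul k)) ?_
    push_cast
    field_simp
    ring
  rw [intervalIntegral.integral_eq_sub_of_hasDerivAt hderiv
    (Continuous.intervalIntegrable (by fun_prop) _ _)]
  field_simp
  ring

/-- The integral over an Eulerian cell of a squared affine function of the local coordinates. -/
lemma setIntegral_eulerianCell_affine_sq {Δx Δy : ℝ} (hΔx : 0 < Δx) (hΔy : 0 < Δy)
    (xi yj p r s : ℝ) :
    ∫ z in eulerianCell Δx Δy xi yj,
        (p + r * ((z.1 - xi) / Δx) + s * ((z.2 - yj) / Δy)) ^ 2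
      = Δx * Δy * (p ^ 2 + r ^ 2 / 12 + s ^ 2 / 12) := by
  have hint : IntegrableOn
      (fun z : ℝ × ℝ => (p + r * ((z.1 - xi) / Δx) + s * ((z.2 - yj) / Δy)) ^ 2)
      (eulerianCell Δx Δy xi yj) (volume.prod volume) :=
    ContinuousOn.integrableOn_compact (isCompact_Icc.prod isCompact_Icc)
      (Continuous.continuousOn (by fun_prop))
  have hinner : ∀ x : ℝ,
      ∫ y in Set.Icc (yj - Δy / 2) (yj + Δy / 2),
        (p + r * ((x - xi) / Δx) + s * ((y - yj) / Δy)) ^ 2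
      = Δy * ((p + r * ((x - xi) / Δx)) ^ 2 + s ^ 2 / 12) := by
    intro x
    simpa using setIntegral_Icc_affine_sq_add hΔy yj (p + r * ((x - xi) / Δx)) s 0
  rw [eulerianCell, Measure.volume_eq_prod, setIntegral_prod _ hint]
  simp only [hinner]
  rw [integral_const_mul, setIntegral_Icc_affine_sq_add hΔx]
  ring

/-- The derivative of a quadratic polynomial in the scaled coordinate `(t - m) / d`. -/
lemma deriv_scaled_quadratic (m d c₀ c₁ c₂ t : ℝ) :
    deriv (fun t => c₀ + c₁ * ((t - m) / d) + c₂ * ((t - m) / d) ^ 2) t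
      = (c₁ + 2 * c₂ * ((t - m) / d)) / d := by
  have h := ((hasDerivAt_id' t).sub_const m).div_const d
  refine (HasDerivAt.deriv (((h.const_mul c₁).const_add c₀).add
    ((h.pow 2).const_mul c₂))).trans ?_
  push_cast
  ring

/-- Explicit formula for the Jiang–Shu smoothness indicator `β₀` of the quadratic
polynomial `q` written in the local orthogonal basis
`{1, μ, ν, μ² - 1/12, μν, ν² - 1/12}` on the Eulerian cell. -/
theorem smoothness_indicator_quadratic
    (Δx Δy : ℝ) (hΔx : 0 < Δx) (hΔy : 0 < Δy) (xi yj : ℝ)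
    (a1 a2 a3 a4 a5 a6 : ℝ) (q : ℝ → ℝ → ℝ)
    (hq : ∀ x y, q x y =
      a1 + a2 * ((x - xi) / Δx) + a3 * ((y - yj) / Δy)
        + a4 * (((x - xi) / Δx) ^ 2 - 1 / 12)
        + a5 * ((x - xi) / Δx) * ((y - yj) / Δy)
        + a6 * (((y - yj) / Δy) ^ 2 - 1 / 12)) :
    (1 / (Δx * Δy)) *
      ((∫ z in eulerianCell Δx Δy xi yj,
          (Δx * deriv (fun x' => q x' z.2) z.1) ^ 2)
        + (∫ z in eulerianCell Δx Δy xi yj,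
          (Δy * deriv (fun y' => q z.1 y') z.2) ^ 2)
        + (∫ z in eulerianCell Δx Δy xi yj,
          (Δx ^ 2 * deriv (fun x' => deriv (fun x'' => q x'' z.2) x') z.1) ^ 2)
        + (∫ z in eulerianCell Δx Δy xi yj,
          (Δx * Δy * deriv (fun x' => deriv (fun y' => q x' y') z.2) z.1) ^ 2)
        + (∫ z in eulerianCell Δx Δy xi yj,
          (Δy ^ 2 * deriv (fun y'' => deriv (fun y' => q z.1 y') y'') z.2) ^ 2))
    = a2 ^ 2 + a3 ^ 2 + (13 / 3) * a4 ^ 2 + (7 / 6) * a5 ^ 2 + (13 / 3) * a6 ^ 2 := by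
  have hx : ∀ x y, deriv (fun x' => q x' y) x
      = (a2 + 2 * a4 * ((x - xi) / Δx) + a5 * ((y - yj) / Δy)) / Δx := by
    intro x y
    rw [add_right_comm, ← deriv_scaled_quadratic xi Δx (a1 + a3 * ((y - yj) / Δy) - a4 / 12
      + a6 * (((y - yj) / Δy) ^ 2 - 1 / 12))]
    congr 1
    funext t
    rw [hq]
    ring
  have hy : ∀ x y, deriv (fun y' => q x y') y
      = (a3 + a5 * ((x - xi) / Δx) + 2 * a6 * ((y - yj) / Δy)) / Δy := by
    intro x y
    rw [← deriv_scaled_quadratic yj Δy (a1 + a2 * ((x - xi) / Δx) - a6 / 12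
      + a4 * (((x - xi) / Δx) ^ 2 - 1 / 12))]
    congr 1
    funext t
    rw [hq]
    ring
  have haffine : ∀ m d e c₀ c₁ t : ℝ,
      deriv (fun t => (c₀ + c₁ * ((t - m) / d)) / e) t = c₁ / d / e := by
    intro m d e c₀ c₁ t
    rw [deriv_div_const]
    simpa using congrArg (· / e) (deriv_scaled_quadratic m d c₀ c₁ 0 t)
  have hxy : ∀ x y, deriv (fun x' => deriv (fun y' => q x' y') y) x = a5 / Δx / Δy := by
    intro x y
    simp only [hy]
    rw [← haffine xi Δx Δy (a3 + 2 * a6 * ((y - yj) / Δy)) a5 x]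
    congr 1
    funext t
    ring
  have h₁ := setIntegral_eulerianCell_affine_sq hΔx hΔy xi yj a2 (2 * a4) a5
  have h₂ := setIntegral_eulerianCell_affine_sq hΔx hΔy xi yj a3 a5 (2 * a6)
  have hconst : ∀ p : ℝ, ∫ _ in eulerianCell Δx Δy xi yj, p ^ 2 = Δx * Δy * p ^ 2 := by
    intro p
    simpa using setIntegral_eulerianCell_affine_sq hΔx hΔy xi yj p 0 0
  have e₁ : ∀ A : ℝ, Δx * (A / Δx) = A := fun A => by field_simp
  have e₂ : ∀ A : ℝ, Δy * (A / Δy) = A := fun A => by field_simp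
  have e₃ : Δx ^ 2 * (2 * a4 / Δx / Δx) = 2 * a4 := by field_simp
  have e₄ : Δx * Δy * (a5 / Δx / Δy) = a5 := by field_simp
  have e₅ : Δy ^ 2 * (2 * a6 / Δy / Δy) = 2 * a6 := by field_simp
  simp only [hxy]
  have hxx : ∀ x y, deriv (fun x' => deriv (fun x'' => q x'' y) x') x = 2 * a4 / Δx / Δx := by
    intro x y
    simp only [hx, add_right_comm a2, haffine]
  simp only [hxx]
  simp only [hx, hy, haffine, e₁, e₂, e₃, e₄, e₅, hconst, h₁, h₂]
  field_simp
  ring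
end

section
/- Let h > 0, x ∈ ℝ, and let u : ℝ → ℝ be six times continuously differentiable with |u⁽⁶⁾(y)| ≤ M for all y ∈ [x − 3h, x + 3h]. For k ∈ {−2, −1, 0, 1, 2} define the cell averages ū_k = (1/h) ∫_{x + kh − h/2}^{x + kh + h/2} u(y) dy. Then | (1/h²)·( −(1/12)·ū_{−2} + (4/3)·ū_{−1} − (5/2)·ū_0 + (4/3)·ū_1 − (1/12)·ū_2 ) − (1/h) ∫_{x − h/2}^{x + h/2} u''(y) dy | ≤ M·h⁴/54. -/
open intervalIntegral

/-- Taylor's theorem with the Lagrange bound on the remainder, for increments of either sign. -/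
theorem abs_sub_taylor_sum_le {f : ℝ → ℝ} {n : ℕ} (hf : ContDiff ℝ (n + 1) f) {x t M : ℝ}
    (ht : t ≠ 0) (hM : ∀ y ∈ Set.uIcc x (x + t), |iteratedDeriv (n + 1) f y| ≤ M) :
    |f (x + t) - ∑ k ∈ Finset.range (n + 1), t ^ k / k.factorial * iteratedDeriv k f x|
      ≤ M * |t| ^ (n + 1) / (n + 1).factorial := by
  have hne : x ≠ x + t := by simpa [eq_comm] using ht
  obtain ⟨y, hy, hrem⟩ := taylor_mean_remainder_lagrange_iteratedDeriv hne hf.contDiffOn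
  have hsum : taylorWithinEval f n (Set.uIcc x (x + t)) x (x + t)
      = ∑ k ∈ Finset.range (n + 1), t ^ k / k.factorial * iteratedDeriv k f x := by
    rw [taylor_within_apply]
    refine Finset.sum_congr rfl fun k hk => ?_
    have hk' : (k : WithTop ℕ∞) ≤ n + 1 := by
      exact_mod_cast (Finset.mem_range.mp hk).le
    rw [iteratedDerivWithin_eq_iteratedDeriv (uniqueDiffOn_uIcc hne)
      (hf.of_le hk').contDiffAt Set.left_mem_uIcc, add_sub_cancel_left, smul_eq_mul,
      inv_mul_eq_div]
  rw [← hsum, hrem, add_sub_cancel_left, abs_div, abs_mul, abs_pow, Nat.abs_cast]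
  gcongr
  exact hM y (Set.uIoo_subset_uIcc_self hy)

/-- Truncation error of the five-point finite-difference approximation of the second derivative,
multiplied by `h ^ 2`. -/
theorem abs_five_point_stencil_sub_le {u : ℝ → ℝ} (hu : ContDiff ℝ 6 u) {h y M : ℝ} (hh : 0 < h)
    (hM : ∀ z ∈ Set.Icc (y - 2 * h) (y + 2 * h), |iteratedDeriv 6 u z| ≤ M) :
    |-(1 / 12) * u (y + -2 * h) + (4 / 3) * u (y + -1 * h) - (5 / 2) * u y
        + (4 / 3) * u (y + 1 * h) - (1 / 12) * u (y + 2 * h) - h ^ 2 * deriv (deriv u) y|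
      ≤ M * h ^ 6 / 54 := by
  have taylor : ∀ c : ℝ, c ≠ 0 → |c| ≤ 2 →
      |u (y + c * h) - ∑ k ∈ Finset.range 6, (c * h) ^ k / k.factorial * iteratedDeriv k u y|
        ≤ M * (|c| * h) ^ 6 / 720 := by
    intro c hc hc2
    have hc' := abs_le.mp hc2
    have := abs_sub_taylor_sum_le (n := 5) (f := u) (x := y) (t := c * h) (M := M)
      (by norm_num; exact hu) (mul_ne_zero hc hh.ne') (fun z hz => hM z
        (Set.uIcc_subset_Icc ⟨by linarith, by linarith⟩ ⟨by nlinarith, by nlinarith⟩ hz))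
    simpa [abs_mul, abs_of_pos hh, Nat.factorial] using this
  have h2 : iteratedDeriv 2 u y = deriv (deriv u) y := by
    simp [iteratedDeriv_succ, iteratedDeriv_zero]
  have t1 := abs_le.mp (taylor (-2) (by norm_num) (by norm_num))
  have t2 := abs_le.mp (taylor (-1) (by norm_num) (by norm_num))
  have t3 := abs_le.mp (taylor 1 (by norm_num) (by norm_num))
  have t4 := abs_le.mp (taylor 2 (by norm_num) (by norm_num))
  simp only [Finset.sum_range_succ, Finset.sum_range_zero, h2, iteratedDeriv_zero, abs_neg,
    abs_one, Nat.abs_ofNat, Nat.factorial] at t1 t2 t3 t4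
  norm_num [mul_pow] at t1 t2 t3 t4
  rw [abs_le]
  norm_num
  constructor <;> linarith

/-- Fourth-order accuracy of the five-point finite-volume differential operator
`[-1/12, 4/3, -5/2, 4/3, -1/12]/h²` applied to cell averages: it recovers the
cell average of `u''` with error at most `M h⁴ / 54`. -/
theorem fv_laplacian_fourth_order
    (h : ℝ) (hh : 0 < h) (x : ℝ) (u : ℝ → ℝ) (M : ℝ)
    (hu : ContDiff ℝ 6 u)
    (hM : ∀ y ∈ Set.Icc (x - 3 * h) (x + 3 * h), |iteratedDeriv 6 u y| ≤ M)
    (ubar : ℤ → ℝ)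
    (hubar : ∀ k : ℤ, ubar k =
      (1 / h) * ∫ y in (x + (k : ℝ) * h - h / 2)..(x + (k : ℝ) * h + h / 2), u y) :
    |(1 / h ^ 2) *
        (-(1 / 12) * ubar (-2) + (4 / 3) * ubar (-1) - (5 / 2) * ubar 0
          + (4 / 3) * ubar 1 - (1 / 12) * ubar 2)
      - (1 / h) * ∫ y in (x - h / 2)..(x + h / 2), deriv (deriv u) y|
    ≤ M * h ^ 4 / 54 := by
  have hc : Continuous u := hu.continuous
  have hc2 : Continuous (deriv (deriv u)) := by
    have := hu.continuous_iteratedDeriv 2 (by norm_num)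
    simpa [iteratedDeriv_succ, iteratedDeriv_zero] using this
  have shift : ∀ k : ℤ, ubar k =
      (1 / h) * ∫ y in (x - h / 2)..(x + h / 2), u (y + (k : ℝ) * h) := by
    intro k
    rw [hubar, integral_comp_add_right]
    congr 2 <;> ring
  have bound := norm_integral_le_of_norm_le_const (a := x - h / 2) (b := x + h / 2)
    (C := M * h ^ 6 / 54)
    (f := fun y => -(1 / 12) * u (y + -2 * h) + (4 / 3) * u (y + -1 * h) - (5 / 2) * u y
        + (4 / 3) * u (y + 1 * h) - (1 / 12) * u (y + 2 * h) - h ^ 2 * deriv (deriv u) y)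
    (fun y hy => by
      rw [Set.uIoc_of_le (by linarith)] at hy
      exact abs_five_point_stencil_sub_le hu hh fun z hz =>
        hM z ⟨by linarith [hy.1, hz.1], by linarith [hy.2, hz.2]⟩)
  have hushift : ∀ c : ℝ, IntervalIntegrable (fun y => u (y + c * h)) MeasureTheory.volume
      (x - h / 2) (x + h / 2) := fun c =>
    (hc.comp (by fun_prop : Continuous fun y => y + c * h)).intervalIntegrable _ _
  have hu0 := hc.intervalIntegrable (μ := MeasureTheory.volume) (x - h / 2) (x + h / 2)
  have hu2 := hc2.intervalIntegrable (μ := MeasureTheory.volume) (x - h / 2) (x + h / 2)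
  have i1 := (hushift (-2)).const_mul (-(1 / 12))
  have i2 := i1.add ((hushift (-1)).const_mul (4 / 3))
  have i3 := i2.sub (hu0.const_mul (5 / 2))
  have i4 := i3.add ((hushift 1).const_mul (4 / 3))
  have i5 := i4.sub ((hushift 2).const_mul (1 / 12))
  rw [integral_sub i5 (hu2.const_mul _), integral_sub i4 ((hushift 2).const_mul _),
    integral_add i3 ((hushift 1).const_mul _), integral_sub i2 (hu0.const_mul _),
    integral_add i1 ((hushift (-1)).const_mul _)] at bound
  simp only [integral_const_mul] at bound
  rw [Real.norm_eq_abs, show x + h / 2 - (x - h / 2) = h by ring, abs_of_pos hh] at bound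
  rw [shift, shift, shift, shift, shift]
  push_cast
  simp only [zero_mul, add_zero]
  refine le_of_mul_le_mul_left ?_ (pow_pos hh 3)
  have hrhs : h ^ 3 * (M * h ^ 4 / 54) = M * h ^ 6 / 54 * h := by ring
  rw [hrhs, ← abs_of_pos (pow_pos hh 3), ← abs_mul]
  refine le_of_eq_of_le (congrArg abs ?_) bound
  field_simp
end

section
/- Let Δx, Δy > 0 and x_i, y_j ∈ ℝ, and set μ(x) = (x − x_i)/Δx, ν(y) = (y − y_j)/Δy. For a ∈ ℝ⁶ define the quadratic polynomial q_a(x,y) = a₁ + a₂·μ(x) + a₃·ν(y) + a₄·(μ(x)² − 1/12) + a₅·μ(x)·ν(y) + a₆·(ν(y)² − 1/12). For (p, r) ∈ {−1, 0, 1}² let I_{p,r} = [x_i + (p − 1/2)Δx, x_i + (p + 1/2)Δx] × [y_j + (r − 1/2)Δy, y_j + (r + 1/2)Δy], and let real data ū_{p,r} be given for all (p,r) ∈ {−1,0,1}². Define the constraint set V = { a ∈ ℝ⁶ : (1/(ΔxΔy)) ∫∫_{I_{p,r}} q_a = ū_{p,r} for (p,r) ∈ {(0,0), (0,−1), (−1,0),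 (1,0), (0,1)} } and the least-squares functional E(a) = ( Σ_{(p,r) ∈ {(−1,−1),(1,−1),(−1,1),(1,1)}} ( (1/(ΔxΔy)) ∫∫_{I_{p,r}} q_a − ū_{p,r} )² )^{1/2}. Then there exists a unique a* ∈ V such that E(a*) = min_{a ∈ V} E(a). -/
open MeasureTheory

/-- The quadratic polynomial `q_a` in the local orthogonal basis
`{1, μ, ν, μ² - 1/12, μν, ν² - 1/12}` with `μ(x) = (x - xᵢ)/Δx`, `ν(y) = (y - yⱼ)/Δy`. -/
noncomputable def qPoly (Δx Δy xi yj : ℝ) (a : Fin 6 → ℝ) (x y : ℝ) : ℝ :=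
  a 0 + a 1 * ((x - xi) / Δx) + a 2 * ((y - yj) / Δy)
    + a 3 * (((x - xi) / Δx) ^ 2 - 1 / 12)
    + a 4 * ((x - xi) / Δx) * ((y - yj) / Δy)
    + a 5 * (((y - yj) / Δy) ^ 2 - 1 / 12)

/-- The Eulerian cell `I_{p,r}` of the uniform mesh. -/
def meshCell (Δx Δy xi yj : ℝ) (p r : ℤ) : Set (ℝ × ℝ) :=
  Set.Icc (xi + ((p : ℝ) - 1 / 2) * Δx) (xi + ((p : ℝ) + 1 / 2) * Δx) ×ˢ
    Set.Icc (yj + ((r : ℝ) - 1 / 2) * Δy) (yj + ((r : ℝ) + 1 / 2) * Δy)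

/-- The cell average of `q_a` over the cell `I_{p,r}`. -/
noncomputable def cellAvg (Δx Δy xi yj : ℝ) (a : Fin 6 → ℝ) (p r : ℤ) : ℝ :=
  (1 / (Δx * Δy)) * ∫ z in meshCell Δx Δy xi yj p r, qPoly Δx Δy xi yj a z.1 z.2

/-- The constraint set `V`: quadratics matching the cell averages over the central cell
and its four edge neighbors. -/
def Vset (Δx Δy xi yj : ℝ) (ubar : ℤ → ℤ → ℝ) : Set (Fin 6 → ℝ) :=
  {a | cellAvg Δx Δy xi yj a 0 0 = ubar 0 0
    ∧ cellAvg Δx Δy xi yj a 0 (-1) = ubar 0 (-1)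
    ∧ cellAvg Δx Δy xi yj a (-1) 0 = ubar (-1) 0
    ∧ cellAvg Δx Δy xi yj a 1 0 = ubar 1 0
    ∧ cellAvg Δx Δy xi yj a 0 1 = ubar 0 1}

/-- The least-squares functional `E`: the root of the sum of squared residuals of the
cell averages over the four corner-neighbor cells. -/
noncomputable def Efun (Δx Δy xi yj : ℝ) (ubar : ℤ → ℤ → ℝ) (a : Fin 6 → ℝ) : ℝ :=
  Real.sqrt ((cellAvg Δx Δy xi yj a (-1) (-1) - ubar (-1) (-1)) ^ 2
    + (cellAvg Δx Δy xi yj a 1 (-1) - ubar 1 (-1)) ^ 2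
    + (cellAvg Δx Δy xi yj a (-1) 1 - ubar (-1) 1) ^ 2
    + (cellAvg Δx Δy xi yj a 1 1 - ubar 1 1) ^ 2)

/-- Integral of a quadratic in the scaled variable `(t - t₀)/h` over the one-dimensional cell with
index `p`. -/
theorem integral_quadratic_cell (h t₀ c₀ c₁ c₂ p : ℝ) (hh : 0 < h) :
    ∫ t in Set.Icc (t₀ + (p - 1 / 2) * h) (t₀ + (p + 1 / 2) * h),
        (c₀ + c₁ * ((t - t₀) / h) + c₂ * ((t - t₀) / h) ^ 2)
      = h * (c₀ + c₁ * p + c₂ * (p ^ 2 + 1 / 12)) := by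
  have hle : t₀ + (p - 1 / 2) * h ≤ t₀ + (p + 1 / 2) * h := by nlinarith
  rw [integral_Icc_eq_integral_Ioc, ← intervalIntegral.integral_of_le hle]
  have hderiv : ∀ t : ℝ, HasDerivAt
      (fun t => h * (c₀ * ((t - t₀) / h) + c₁ / 2 * ((t - t₀) / h) ^ 2
        + c₂ / 3 * ((t - t₀) / h) ^ 3))
      (c₀ + c₁ * ((t - t₀) / h) + c₂ * ((t - t₀) / h) ^ 2) t := by
    intro t
    have hs : HasDerivAt (fun t => (t - t₀) / h) (1 / h) t :=
      ((hasDerivAt_id t).sub_const t₀).div_const h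
    have hsum := (((hs.const_mul c₀).add ((hs.pow 2).const_mul (c₁ / 2))).add
      ((hs.pow 3).const_mul (c₂ / 3))).const_mul h
    refine hsum.congr_deriv ?_
    push_cast
    field_simp
  rw [intervalIntegral.integral_eq_sub_of_hasDerivAt (fun t _ => hderiv t)
    ((by fun_prop : Continuous _).intervalIntegrable _ _)]
  field_simp
  ring

/-- The cell average of `q_a` is a quadratic form in the cell indices. -/
theorem cellAvg_eq (Δx Δy : ℝ) (hΔx : 0 < Δx) (hΔy : 0 < Δy) (xi yj : ℝ) (a : Fin 6 → ℝ)
    (p r : ℤ) :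
    cellAvg Δx Δy xi yj a p r
      = a 0 + a 1 * p + a 2 * r + a 3 * (p : ℝ) ^ 2 + a 4 * p * r + a 5 * (r : ℝ) ^ 2 := by
  have hcont : Continuous fun z : ℝ × ℝ => qPoly Δx Δy xi yj a z.1 z.2 := by
    unfold qPoly
    fun_prop
  unfold cellAvg meshCell
  rw [Measure.volume_eq_prod, setIntegral_prod _
    (hcont.continuousOn.integrableOn_compact (isCompact_Icc.prod isCompact_Icc))]
  have hinner : ∀ x : ℝ,
      ∫ y in Set.Icc (yj + ((r : ℝ) - 1 / 2) * Δy) (yj + ((r : ℝ) + 1 / 2) * Δy),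
          qPoly Δx Δy xi yj a x y
        = Δy * (a 0 + a 2 * r - a 3 / 12 + a 5 * (r : ℝ) ^ 2)
          + Δy * (a 1 + a 4 * r) * ((x - xi) / Δx) + Δy * a 3 * ((x - xi) / Δx) ^ 2 := by
    intro x
    have hq : ∀ y, qPoly Δx Δy xi yj a x y
        = (a 0 + a 1 * ((x - xi) / Δx) + a 3 * (((x - xi) / Δx) ^ 2 - 1 / 12) - a 5 / 12)
          + (a 2 + a 4 * ((x - xi) / Δx)) * ((y - yj) / Δy) + a 5 * ((y - yj) / Δy) ^ 2 := by
      intro y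
      unfold qPoly
      ring
    simp_rw [hq]
    rw [integral_quadratic_cell _ _ _ _ _ _ hΔy]
    ring
  simp_rw [hinner]
  rw [integral_quadratic_cell _ _ _ _ _ _ hΔx]
  field_simp
  ring

/-- Membership in the constraint set determines every coefficient but that of `μν`. -/
theorem mem_Vset_iff (Δx Δy : ℝ) (hΔx : 0 < Δx) (hΔy : 0 < Δy) (xi yj : ℝ) (ubar : ℤ → ℤ → ℝ)
    (a : Fin 6 → ℝ) :
    a ∈ Vset Δx Δy xi yj ubar ↔
      a 0 = ubar 0 0 ∧ a 1 = (ubar 1 0 - ubar (-1) 0) / 2 ∧ a 2 = (ubar 0 1 - ubar 0 (-1)) / 2 ∧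
        a 3 = (ubar 1 0 + ubar (-1) 0) / 2 - ubar 0 0 ∧
        a 5 = (ubar 0 1 + ubar 0 (-1)) / 2 - ubar 0 0 := by
  simp only [Vset, Set.mem_ofPred_eq, cellAvg_eq Δx Δy hΔx hΔy]
  push_cast
  constructor
  · rintro ⟨h₁, h₂, h₃, h₄, h₅⟩
    refine ⟨?_, ?_, ?_, ?_, ?_⟩ <;> linarith
  · rintro ⟨h₁, h₂, h₃, h₄, h₅⟩
    refine ⟨?_, ?_, ?_, ?_, ?_⟩ <;> rw [h₁, h₂, h₃, h₄, h₅] <;> ring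

/-- On the constraint set, comparing values of the functional amounts to comparing the distances
of the `μν`-coefficients to the mixed second difference of the corner data. -/
theorem Efun_le_Efun_iff (Δx Δy : ℝ) (hΔx : 0 < Δx) (hΔy : 0 < Δy) (xi yj : ℝ)
    (ubar : ℤ → ℤ → ℝ) {a b : Fin 6 → ℝ} (ha : a ∈ Vset Δx Δy xi yj ubar)
    (hb : b ∈ Vset Δx Δy xi yj ubar) :
    Efun Δx Δy xi yj ubar a ≤ Efun Δx Δy xi yj ubar b ↔
      (a 4 - (ubar (-1) (-1) - ubar 1 (-1) - ubar (-1) 1 + ubar 1 1) / 4) ^ 2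
        ≤ (b 4 - (ubar (-1) (-1) - ubar 1 (-1) - ubar (-1) 1 + ubar 1 1) / 4) ^ 2 := by
  obtain ⟨ha₀, ha₁, ha₂, ha₃, ha₅⟩ := (mem_Vset_iff Δx Δy hΔx hΔy xi yj ubar a).1 ha
  obtain ⟨hb₀, hb₁, hb₂, hb₃, hb₅⟩ := (mem_Vset_iff Δx Δy hΔx hΔy xi yj ubar b).1 hb
  unfold Efun
  rw [Real.sqrt_le_sqrt_iff (by positivity)]
  simp only [cellAvg_eq Δx Δy hΔx hΔy, ha₀, ha₁, ha₂, ha₃, ha₅, hb₀, hb₁, hb₂, hb₃, hb₅]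
  push_cast
  constructor <;> intro h <;> linarith

/-- Well-posedness of Step 1 of the third-order WENO-ZQ reconstruction:
there is a unique quadratic in the constraint set `V` minimizing the least-squares
functional `E` over `V`. -/
theorem weno_zq_least_squares_wellposed
    (Δx Δy : ℝ) (hΔx : 0 < Δx) (hΔy : 0 < Δy) (xi yj : ℝ) (ubar : ℤ → ℤ → ℝ) :
    ∃! a : Fin 6 → ℝ, a ∈ Vset Δx Δy xi yj ubar ∧
      ∀ b ∈ Vset Δx Δy xi yj ubar,
        Efun Δx Δy xi yj ubar a ≤ Efun Δx Δy xi yj ubar b := by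
  set c := (ubar (-1) (-1) - ubar 1 (-1) - ubar (-1) 1 + ubar 1 1) / 4 with hc
  let m : Fin 6 → ℝ := ![ubar 0 0, (ubar 1 0 - ubar (-1) 0) / 2, (ubar 0 1 - ubar 0 (-1)) / 2,
    (ubar 1 0 + ubar (-1) 0) / 2 - ubar 0 0, c, (ubar 0 1 + ubar 0 (-1)) / 2 - ubar 0 0]
  have hm : m ∈ Vset Δx Δy xi yj ubar :=
    (mem_Vset_iff Δx Δy hΔx hΔy xi yj ubar m).2 ⟨rfl, rfl, rfl, rfl, rfl⟩
  have hm₄ : m 4 = c := rfl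
  refine ⟨m, ⟨hm, fun b hb => ?_⟩, ?_⟩
  · rw [Efun_le_Efun_iff Δx Δy hΔx hΔy xi yj ubar hm hb, ← hc, hm₄, sub_self]
    exact (zero_pow two_ne_zero).trans_le (sq_nonneg _)
  · rintro a ⟨ha, hmin⟩
    have hle := (Efun_le_Efun_iff Δx Δy hΔx hΔy xi yj ubar ha hm).1 (hmin m hm)
    rw [← hc, hm₄, sub_self, zero_pow two_ne_zero] at hle
    have ha₄ : a 4 = c := sub_eq_zero.1 (pow_eq_zero_iff two_ne_zero |>.1
      (le_antisymm hle (sq_nonneg _)))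
    obtain ⟨ha₀, ha₁, ha₂, ha₃, ha₅⟩ := (mem_Vset_iff Δx Δy hΔx hΔy xi yj ubar a).1 ha
    funext k
    fin_cases k
    exacts [ha₀, ha₁, ha₂, ha₃, ha₄, ha₅]
end
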